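/- If C is the class of sets of a uniformly recursive family (L_i)_{i∈ℕ}, then there is a single prudent learner which simultaneously finitely approximately (FinApprox) learns C, is consistent (Cons), and partially (Part) learns C. -/

import Mathlib

open Filter

/-- The `e`-th partial recursive function in a fixed acceptable numbering. -/
def phi (e : ℕ) : ℕ →. ℕ := Nat.Partrec.Code.eval (Denumerable.ofNat Nat.Partrec.Code e)

/-- The `e`-th recursively enumerable set, `W_e = dom(φ_e)`. -/
def Wset (e : ℕ) : Set ℕ := (phi e).Dom

/-- `T` is a text for `L`: the natural numbers occurring in `T` are exactly
the members of `L` (`none` plays the role of the pause symbol `#`). -/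
def IsText (T : ℕ → Option ℕ) (L : Set ℕ) : Prop :=
  {x : ℕ | ∃ n, T n = some x} = L

/-- The finite sequence `T[n] = T(0), ..., T(n-1)`. -/
def pref (T : ℕ → Option ℕ) (n : ℕ) : List (Option ℕ) :=
  (List.range n).map T

/-- `M` partially (Part) learns `C`: on every text for every `L ∈ C` there is
exactly one index output infinitely often, and that index is an index of `L`. -/
def PartLearns (M : List (Option ℕ) → ℕ) (C : Set (Set ℕ)) : Prop :=
  ∀ L ∈ C, ∀ T : ℕ → Option ℕ, IsText T L →
    ∃ e, {n | M (pref T n) = e}.Infinite ∧ Wset e = L ∧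
      ∀ d, {n | M (pref T n) = d}.Infinite → d = e

/-- `M` is consistent (Cons): every number occurring in `σ` belongs to `W_{M(σ)}`. -/
def ConsLearner (M : List (Option ℕ) → ℕ) : Prop :=
  ∀ σ : List (Option ℕ), ∀ x : ℕ, some x ∈ σ → x ∈ Wset (M σ)

/-- `M` finitely approximately (FinApprox) learns `C`. -/
def FinApproxLearns (M : List (Option ℕ) → ℕ) (C : Set (Set ℕ)) : Prop :=
  ∀ L ∈ C, ∀ T : ℕ → Option ℕ, IsText T L → ∀ D : Finset ℕ,
    ∀ᶠ n in atTop, Wset (M (pref T n)) ∩ ↑D = L ∩ ↑D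

/-- `M` BC*-learns `C`: almost all hypotheses are finite variants of the target. -/
def BCstarLearns (M : List (Option ℕ) → ℕ) (C : Set (Set ℕ)) : Prop :=
  ∀ L ∈ C, ∀ T : ℕ → Option ℕ, IsText T L →
    ∀ᶠ n in atTop, (symmDiff (Wset (M (pref T n))) L).Finite

/-- `M` BC^k-learns `C`: almost all hypotheses differ from the target in at
most `k` elements. -/
def BCnLearns (k : ℕ) (M : List (Option ℕ) → ℕ) (C : Set (Set ℕ)) : Prop :=
  ∀ L ∈ C, ∀ T : ℕ → Option ℕ, IsText T L →
    ∀ᶠ m in atTop, (symmDiff (Wset (M (pref T m))) L).Finite ∧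
      (symmDiff (Wset (M (pref T m))) L).ncard ≤ k

/-- `M` behaviourally correctly (BC) learns `C`. -/
def BCLearns (M : List (Option ℕ) → ℕ) (C : Set (Set ℕ)) : Prop :=
  ∀ L ∈ C, ∀ T : ℕ → Option ℕ, IsText T L →
    ∀ᶠ n in atTop, Wset (M (pref T n)) = L

/-- `M` explanatorily (Ex) learns `C`. -/
def ExLearns (M : List (Option ℕ) → ℕ) (C : Set (Set ℕ)) : Prop :=
  ∀ L ∈ C, ∀ T : ℕ → Option ℕ, IsText T L →
    ∃ e n₀, Wset e = L ∧ ∀ n ≥ n₀, M (pref T n) = e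

/-- `M` weakly approximately (WeakApprox) learns `C`: for every text there is
an infinite set `W` such that on every finite variant `V` of `W` almost all
hypotheses agree with the target. -/
def WeakApproxLearns (M : List (Option ℕ) → ℕ) (C : Set (Set ℕ)) : Prop :=
  ∀ L ∈ C, ∀ T : ℕ → Option ℕ, IsText T L →
    ∃ W : Set ℕ, W.Infinite ∧ ∀ V : Set ℕ, (symmDiff V W).Finite →
      ∀ᶠ n in atTop, Wset (M (pref T n)) ∩ V = L ∩ V

/-- `M` approximately (Approx) learns `C`: for every `L ∈ C` there is an
infinite set `W`, good for all texts for `L`. -/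
def ApproxLearns (M : List (Option ℕ) → ℕ) (C : Set (Set ℕ)) : Prop :=
  ∀ L ∈ C, ∃ W : Set ℕ, W.Infinite ∧ ∀ T : ℕ → Option ℕ, IsText T L →
    ∀ V : Set ℕ, (symmDiff V W).Finite →
      ∀ᶠ n in atTop, Wset (M (pref T n)) ∩ V = L ∩ V

/-- Conservativeness for partial learners: on each text for every `L ∈ C`, `M`
outputs exactly one index `e` with `L ⊆ W_e`. -/
def ConsvLearner (M : List (Option ℕ) → ℕ) (C : Set (Set ℕ)) : Prop :=
  ∀ L ∈ C, ∀ T : ℕ → Option ℕ, IsText T L →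
    ∃! e, (∃ n, M (pref T n) = e) ∧ L ⊆ Wset e

/-- Confidence: on every infinite sequence, `M` outputs exactly one index
infinitely often. -/
def Confident (M : List (Option ℕ) → ℕ) : Prop :=
  ∀ T : ℕ → Option ℕ, ∃! e, {n | M (pref T n) = e}.Infinite

/-- The sets ever conjectured by `M` (used to express prudence). -/
def Conjectured (M : List (Option ℕ) → ℕ) : Set (Set ℕ) :=
  {S | ∃ σ : List (Option ℕ), S = Wset (M σ)}

/-! ### Bounded quantification and search -/

/-- Boolean bounded universal quantification: `p m` holds for all `m < n`. -/
def allBelow (p : ℕ → Bool) (n : ℕ) : Bool :=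
  n.rec true fun m b => b && p m

/-- The least `m < n` with `p m`, or `n` if there is none. -/
def leastBelow (p : ℕ → Bool) (n : ℕ) : ℕ :=
  n.rec 0 fun _ r => bif p r then r else r + 1

theorem allBelow_iff (p : ℕ → Bool) (n : ℕ) : allBelow p n = true ↔ ∀ m < n, p m = true := by
  induction n with
  | zero => simp [allBelow]
  | succ n ih =>
    have h : allBelow p (n + 1) = (allBelow p n && p n) := rfl
    rw [h, Bool.and_eq_true, ih, Nat.forall_lt_succ_right]

theorem leastBelow_spec (p : ℕ → Bool) (n : ℕ) :
    (∀ m < leastBelow p n, p m = false) ∧ leastBelow p n ≤ n ∧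
      (p (leastBelow p n) = true ∨ leastBelow p n = n) := by
  induction n with
  | zero => simp [leastBelow]
  | succ n ih =>
    have h : leastBelow p (n + 1) =
        bif p (leastBelow p n) then leastBelow p n else leastBelow p n + 1 := rfl
    obtain ⟨h₁, h₂, h₃⟩ := ih
    rw [h]
    cases hp : p (leastBelow p n) with
    | true => exact ⟨h₁, by simpa using h₂.trans n.le_succ, Or.inl hp⟩
    | false =>
      have h₄ : leastBelow p n = n := h₃.resolve_left (by simp [hp])
      refine ⟨fun m hm => ?_, by simp [h₂], Or.inr (by simp [h₄])⟩
      rcases Nat.lt_succ_iff_lt_or_eq.1 hm with hm | rfl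
      exacts [h₁ m hm, hp]

theorem leastBelow_eq {p : ℕ → Bool} {n i : ℕ} (hi : i < n) (hp : p i = true)
    (hlt : ∀ j < i, p j = false) : leastBelow p n = i := by
  obtain ⟨h₁, -, h₃⟩ := leastBelow_spec p n
  rcases lt_trichotomy (leastBelow p n) i with h | h | h
  · rcases h₃ with h₃ | h₃
    · simp [hlt _ h] at h₃
    · omega
  · exact h
  · simp [h₁ i h] at hp

theorem Computable.allBelow {α : Type*} [Primcodable α] {p : α → ℕ → Bool} {n : α → ℕ}
    (hp : Computable₂ p) (hn : Computable n) : Computable fun a => allBelow (p a) (n a) :=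
  Computable.nat_rec (h := fun a q => q.2 && p a q.1) hn (Computable.const true)
    (Primrec.and.to_comp.comp (Computable.snd.comp Computable.snd)
      (hp.comp Computable.fst (Computable.fst.comp Computable.snd))).to₂

theorem Computable.leastBelow {α : Type*} [Primcodable α] {p : α → ℕ → Bool} {n : α → ℕ}
    (hp : Computable₂ p) (hn : Computable n) : Computable fun a => leastBelow (p a) (n a) := by
  have hr : Computable fun q : α × ℕ × ℕ => q.2.2 := Computable.snd.comp Computable.snd
  exact Computable.nat_rec (h := fun a q => bif p a q.2 then q.2 else q.2 + 1) hn
    (Computable.const 0)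
    (Computable.cond (hp.comp Computable.fst hr) hr (Computable.succ.comp hr)).to₂

theorem Computable.bool_and {α : Type*} [Primcodable α] {p q : α → Bool}
    (hp : Computable p) (hq : Computable q) : Computable fun a => p a && q a :=
  Primrec.and.to_comp.comp hp hq

theorem Computable.bool_not {α : Type*} [Primcodable α] {p : α → Bool}
    (hp : Computable p) : Computable fun a => !p a :=
  Primrec.not.to_comp.comp hp

/-- A uniformly recursive family has a computable sequence of r.e. indices. -/
theorem exists_computable_index {α : Type*} [Primcodable α] {h : α → ℕ → Bool}
    (hh : Computable₂ h) :
    ∃ s : α → ℕ, Computable s ∧ ∀ a x, x ∈ Wset (s a) ↔ h a x = true := by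
  have hP : Partrec fun q : α × ℕ => bif h q.1 q.2 then Part.some 0 else (Part.none : Part ℕ) :=
    Partrec.cond hh (Computable.const 0).partrec Partrec.none
  obtain ⟨c, hc⟩ := Nat.Partrec.Code.exists_code.1 hP
  refine ⟨fun a => Encodable.encode (c.curry (Encodable.encode a)),
    Computable.encode.comp (Nat.Partrec.Code.primrec₂_curry.to_comp.comp
      (Computable.const c) Computable.encode), fun a x => ?_⟩
  have hdec : Encodable.decode (α := α × ℕ) (Nat.pair (Encodable.encode a) x) = some (a, x) := by
    simp
  simp only [Wset, phi, Denumerable.ofNat_encode, PFun.mem_dom, Nat.Partrec.Code.eval_curry, hc,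
    hdec]
  cases hax : h a x <;> simp [hax]

/-! ### Data contained in a finite sequence -/

/-- Whether `x` occurs in `σ`. -/
def occurs (σ : List (Option ℕ)) (x : ℕ) : Bool := decide (some x ∈ σ)

/-- The least strict upper bound of the numbers occurring in `σ`. -/
def contentBound (σ : List (Option ℕ)) : ℕ :=
  σ.foldr (fun o b => max ((o.map Nat.succ).getD 0) b) 0

/-- The increasing list of the numbers occurring in `σ`. -/
def contentList (σ : List (Option ℕ)) : List ℕ :=
  (List.range (contentBound σ)).filterMap fun x => bif occurs σ x then some x else none

theorem occurs_iff {σ : List (Option ℕ)} {x : ℕ} : occurs σ x = true ↔ some x ∈ σ := by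
  simp [occurs]

theorem contentBound_le_iff {σ : List (Option ℕ)} {m : ℕ} :
    contentBound σ ≤ m ↔ ∀ x, some x ∈ σ → x < m := by
  induction σ with
  | nil => simp [contentBound]
  | cons o σ ih =>
    have h : contentBound (o :: σ) = max ((o.map Nat.succ).getD 0) (contentBound σ) := rfl
    rw [h, max_le_iff, ih]
    cases o with
    | none => simp
    | some y => simp

theorem lt_contentBound {σ : List (Option ℕ)} {x : ℕ} (h : some x ∈ σ) : x < contentBound σ :=
  contentBound_le_iff.1 le_rfl x h

theorem mem_contentList {σ : List (Option ℕ)} {x : ℕ} : x ∈ contentList σ ↔ some x ∈ σ := by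
  simp only [contentList, List.mem_filterMap, List.mem_range]
  constructor
  · rintro ⟨y, -, h⟩
    cases hy : occurs σ y <;> simp [hy] at h
    exact h ▸ occurs_iff.1 hy
  · exact fun h => ⟨x, lt_contentBound h, by simp [occurs_iff.2 h]⟩

theorem contentList_congr {σ τ : List (Option ℕ)} (h : ∀ x, some x ∈ σ ↔ some x ∈ τ) :
    contentList σ = contentList τ := by
  have hb : contentBound σ = contentBound τ :=
    eq_of_forall_ge_iff fun m => by simp only [contentBound_le_iff, h]
  simp only [contentList, occurs, hb, h]

theorem primrec₂_mem {α : Type*} [Primcodable α] [DecidableEq α] :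
    Primrec₂ fun (l : List α) (a : α) => decide (a ∈ l) := by
  have h : Primrec fun q : List α × α => decide (q.1.idxOf q.2 < q.1.length) :=
    (Primrec.nat_lt.comp (Primrec.list_idxOf.comp Primrec.snd Primrec.fst)
      (Primrec.list_length.comp Primrec.fst)).decide
  exact h.of_eq fun q => by simp [List.idxOf_lt_length_iff]

theorem primrec₂_occurs : Primrec₂ occurs :=
  (primrec₂_mem.comp (Primrec.fst (α := List (Option ℕ)) (β := ℕ))
    (Primrec.option_some.comp Primrec.snd)).of_eq fun q => by simp [occurs]

theorem primrec_contentBound : Primrec contentBound := by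
  have h : Primrec fun q : List (Option ℕ) × Option ℕ × ℕ =>
      max ((q.2.1.map Nat.succ).getD 0) q.2.2 :=
    Primrec.nat_max.comp
      (Primrec.option_getD.comp
        (Primrec.option_map (Primrec.fst.comp Primrec.snd) (Primrec.succ.comp Primrec.snd).to₂)
        (Primrec.const 0))
      (Primrec.snd.comp Primrec.snd)
  exact Primrec.list_foldr (h := fun (_ : List (Option ℕ)) (q : Option ℕ × ℕ) =>
    max ((q.1.map Nat.succ).getD 0) q.2)
    Primrec.id (Primrec.const 0) h.to₂

theorem primrec_contentList : Primrec contentList :=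
  Primrec.listFilterMap (Primrec.list_range.comp primrec_contentBound)
    (Primrec.cond primrec₂_occurs (Primrec.option_some.comp Primrec.snd) (Primrec.const none)).to₂

/-! ### The learner -/

/-- The content of `σ` and the `i`-th set of the family decided by `g` agree below `k`. -/
def agrees (g : ℕ → ℕ → Bool) (σ : List (Option ℕ)) (k i : ℕ) : Bool :=
  allBelow (fun x => occurs σ x == g i x) k

/-- `i` is supported at level `k` by `σ`: the `i`-th set contains the content of `σ`, and `i` is
the least index of a set agreeing with this content below `k`; moreover `i` and `k` are bounded
in terms of the content. -/
def supported (g : ℕ → ℕ → Bool) (σ : List (Option ℕ)) (k i : ℕ) : Bool :=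
  (decide (i ≤ contentBound σ) && decide (k ≤ contentBound σ)) &&
    (allBelow (fun x => !occurs σ x || g i x) (contentBound σ) &&
      (agrees g σ k i && allBelow (fun j => !agrees g σ k j) i))

/-- `i` is supported at level `k` by `σ` but by no proper prefix of `σ`. -/
def newlySupported (g : ℕ → ℕ → Bool) (σ : List (Option ℕ)) (k i : ℕ) : Bool :=
  supported g σ k i && allBelow (fun m => !supported g (σ.take m) k i) σ.length

/-- `i` is newly supported by `σ` at some level. -/
def candidate (g : ℕ → ℕ → Bool) (σ : List (Option ℕ)) (i : ℕ) : Bool :=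
  !allBelow (fun k => !newlySupported g σ k i) (contentBound σ + 1)

/-- The least candidate, if there is one. -/
def leastCandidate (g : ℕ → ℕ → Bool) (σ : List (Option ℕ)) : ℕ :=
  leastBelow (candidate g σ) (contentBound σ + 1)

/-- The learner that conjectures the set of the least candidate if there is one, and the content
of the input otherwise. Here `s i` is an index of the `i`-th set of the family and `f l` is an
index of the set of members of `l`. -/
def learner (g : ℕ → ℕ → Bool) (s : ℕ → ℕ) (f : List ℕ → ℕ) (σ : List (Option ℕ)) : ℕ :=
  bif candidate g σ (leastCandidate g σ) then s (leastCandidate g σ) else f (contentList σ)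

section Computability

variable {g : ℕ → ℕ → Bool}

theorem computable_agrees (hg : Computable₂ g) :
    Computable fun q : List (Option ℕ) × ℕ × ℕ => agrees g q.1 q.2.1 q.2.2 := by
  refine Computable.allBelow (p := fun (q : List (Option ℕ) × ℕ × ℕ) x =>
    occurs q.1 x == g q.2.2 x) ?_ (Computable.fst.comp Computable.snd)
  exact Primrec.beq.to_comp.comp
    (primrec₂_occurs.to_comp.comp (Computable.fst.comp Computable.fst) Computable.snd)
    (hg.comp (Computable.snd.comp (Computable.snd.comp Computable.fst)) Computable.snd)

theorem computable_supported (hg : Computable₂ g) :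
    Computable fun q : List (Option ℕ) × ℕ × ℕ => supported g q.1 q.2.1 q.2.2 := by
  have hb : Computable fun q : List (Option ℕ) × ℕ × ℕ => contentBound q.1 :=
    primrec_contentBound.to_comp.comp Computable.fst
  have hk : Computable fun q : List (Option ℕ) × ℕ × ℕ => q.2.1 :=
    Computable.fst.comp Computable.snd
  have hi : Computable fun q : List (Option ℕ) × ℕ × ℕ => q.2.2 :=
    Computable.snd.comp Computable.snd
  have hle : Computable₂ fun a b : ℕ => decide (a ≤ b) := Primrec.nat_le.decide.to_comp
  refine Computable.bool_and
    (Computable.bool_and (hle.comp hi hb) (hle.comp hk hb))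
    (Computable.bool_and
      (Computable.allBelow (p := fun (q : List (Option ℕ) × ℕ × ℕ) x =>
        !occurs q.1 x || g q.2.2 x) ?_ hb)
      (Computable.bool_and (computable_agrees hg)
        (Computable.allBelow (p := fun (q : List (Option ℕ) × ℕ × ℕ) j =>
          !agrees g q.1 q.2.1 j) ?_ hi)))
  · exact Primrec.or.to_comp.comp
      (Computable.bool_not
        (primrec₂_occurs.to_comp.comp (Computable.fst.comp Computable.fst) Computable.snd))
      (hg.comp (hi.comp Computable.fst) Computable.snd)
  · have h : Computable fun r : (List (Option ℕ) × ℕ × ℕ) × ℕ =>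
        agrees g r.1.1 r.1.2.1 r.2 :=
      (computable_agrees hg).comp
        (g := fun r : (List (Option ℕ) × ℕ × ℕ) × ℕ => (r.1.1, r.1.2.1, r.2))
        ((Computable.fst.comp Computable.fst).pair ((hk.comp Computable.fst).pair Computable.snd))
    exact h.bool_not

theorem computable_newlySupported (hg : Computable₂ g) :
    Computable fun q : List (Option ℕ) × ℕ × ℕ => newlySupported g q.1 q.2.1 q.2.2 := by
  refine Computable.bool_and (computable_supported hg)
    (Computable.allBelow (p := fun (q : List (Option ℕ) × ℕ × ℕ) m =>
      !supported g (q.1.take m) q.2.1 q.2.2) ?_ (Computable.list_length.comp Computable.fst))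
  have h : Computable fun r : (List (Option ℕ) × ℕ × ℕ) × ℕ =>
      supported g (r.1.1.take r.2) r.1.2.1 r.1.2.2 :=
    (computable_supported hg).comp
      (g := fun r : (List (Option ℕ) × ℕ × ℕ) × ℕ => (r.1.1.take r.2, r.1.2))
      ((Primrec.list_take.to_comp.comp Computable.snd (Computable.fst.comp Computable.fst)).pair
        (Computable.snd.comp Computable.fst))
  exact h.bool_not

theorem computable_candidate (hg : Computable₂ g) : Computable₂ (candidate g) := by
  refine Computable.bool_not
    (Computable.allBelow (p := fun (q : List (Option ℕ) × ℕ) k =>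
      !newlySupported g q.1 k q.2) ?_
      (Computable.succ.comp (primrec_contentBound.to_comp.comp Computable.fst)))
  have h : Computable fun r : (List (Option ℕ) × ℕ) × ℕ => newlySupported g r.1.1 r.2 r.1.2 :=
    (computable_newlySupported hg).comp
      (g := fun r : (List (Option ℕ) × ℕ) × ℕ => (r.1.1, r.2, r.1.2))
      ((Computable.fst.comp Computable.fst).pair
        (Computable.snd.pair (Computable.snd.comp Computable.fst)))
  exact h.bool_not

theorem computable_learner (hg : Computable₂ g) {s : ℕ → ℕ} {f : List ℕ → ℕ}
    (hs : Computable s) (hf : Computable f) : Computable (learner g s f) := by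
  have hc : Computable (leastCandidate g) :=
    Computable.leastBelow (computable_candidate hg)
      (Computable.succ.comp primrec_contentBound.to_comp)
  exact Computable.cond ((computable_candidate hg).comp Computable.id hc) (hs.comp hc)
    (hf.comp primrec_contentList.to_comp)

end Computability

/-! ### Unfolding the definition of the learner -/

section Specification

variable {g : ℕ → ℕ → Bool} {σ : List (Option ℕ)} {k i : ℕ}

theorem agrees_iff : agrees g σ k i = true ↔ ∀ x < k, (some x ∈ σ ↔ g i x = true) := by
  rw [agrees, allBelow_iff]
  refine forall₂_congr fun x _ => ?_
  rw [beq_iff_eq, Bool.eq_iff_iff, occurs_iff]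

theorem supported_iff : supported g σ k i = true ↔
    i ≤ contentBound σ ∧ k ≤ contentBound σ ∧ (∀ x, some x ∈ σ → g i x = true) ∧
      agrees g σ k i = true ∧ ∀ j < i, agrees g σ k j = false := by
  have h : (∀ x < contentBound σ, occurs σ x = false ∨ g i x = true) ↔
      ∀ x, some x ∈ σ → g i x = true := by
    refine forall_congr' fun x => ?_
    rw [← Bool.not_eq_true, ← imp_iff_not_or, occurs_iff]
    exact ⟨fun h hx => h (lt_contentBound hx) hx, fun h _ => h⟩
  simp only [supported, Bool.and_eq_true, decide_eq_true_eq, allBelow_iff, Bool.or_eq_true,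
    Bool.not_eq_true', h, and_assoc]

theorem newlySupported_iff : newlySupported g σ k i = true ↔
    supported g σ k i = true ∧ ∀ m < σ.length, supported g (σ.take m) k i = false := by
  simp [newlySupported, allBelow_iff]

theorem candidate_iff : candidate g σ i = true ↔ ∃ k, newlySupported g σ k i = true := by
  have h : candidate g σ i = true ↔
      ∃ k < contentBound σ + 1, newlySupported g σ k i = true := by
    rw [candidate, Bool.not_eq_true', ← Bool.not_eq_true, allBelow_iff]
    simp
  rw [h]
  refine ⟨fun ⟨k, _, hk⟩ => ⟨k, hk⟩, fun ⟨k, hk⟩ => ⟨k, Nat.lt_succ_of_le ?_, hk⟩⟩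
  exact (supported_iff.1 (newlySupported_iff.1 hk).1).2.1

theorem learner_eq_of_candidate {s : ℕ → ℕ} {f : List ℕ → ℕ} (hi : candidate g σ i = true)
    (hlt : ∀ j < i, candidate g σ j = false) : learner g s f σ = s i := by
  obtain ⟨k, hk⟩ := candidate_iff.1 hi
  have hib : i < contentBound σ + 1 :=
    Nat.lt_succ_of_le (supported_iff.1 (newlySupported_iff.1 hk).1).1
  have h : leastCandidate g σ = i := leastBelow_eq hib hi hlt
  simp [learner, h, hi]

theorem learner_cases (g : ℕ → ℕ → Bool) (s : ℕ → ℕ) (f : List ℕ → ℕ) (σ : List (Option ℕ)) :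
    (∃ i k, newlySupported g σ k i = true ∧ learner g s f σ = s i) ∨
      learner g s f σ = f (contentList σ) := by
  cases h : candidate g σ (leastCandidate g σ) with
  | true =>
    obtain ⟨k, hk⟩ := candidate_iff.1 h
    exact Or.inl ⟨_, k, hk, by simp [learner, h]⟩
  | false => exact Or.inr (by simp [learner, h])

end Specification

/-! ### Prefixes of texts -/

theorem mem_pref {T : ℕ → Option ℕ} {n x : ℕ} : some x ∈ pref T n ↔ ∃ m < n, T m = some x := by
  simp [pref]

theorem take_pref (T : ℕ → Option ℕ) {m n : ℕ} (h : m ≤ n) : (pref T n).take m = pref T m := by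
  simp [pref, ← List.map_take, List.take_range, h]

theorem length_pref (T : ℕ → Option ℕ) (n : ℕ) : (pref T n).length = n := by simp [pref]

theorem contentBound_pref_mono (T : ℕ → Option ℕ) : Monotone fun n => contentBound (pref T n) := by
  intro m n hmn
  refine contentBound_le_iff.2 fun x hx => lt_contentBound ?_
  obtain ⟨l, hl, hx⟩ := mem_pref.1 hx
  exact mem_pref.2 ⟨l, hl.trans_le hmn, hx⟩

section Texts

variable {T : ℕ → Option ℕ} {X : Set ℕ}

theorem IsText.mem_of_mem_pref (hT : IsText T X) {n x : ℕ} (h : some x ∈ pref T n) : x ∈ X := by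
  obtain ⟨m, -, hm⟩ := mem_pref.1 h
  exact hT ▸ ⟨m, hm⟩

theorem IsText.eventually_mem_iff (hT : IsText T X) (x : ℕ) :
    ∀ᶠ n in atTop, (some x ∈ pref T n ↔ x ∈ X) := by
  by_cases hx : x ∈ X
  · obtain ⟨m, hm⟩ : ∃ m, T m = some x := by rw [← hT] at hx; exact hx
    filter_upwards [eventually_gt_atTop m] with n hn
    exact iff_of_true (mem_pref.2 ⟨m, hn, hm⟩) hx
  · exact Eventually.of_forall fun n => iff_of_false (fun h => hx (hT.mem_of_mem_pref h)) hx

theorem IsText.eventually_forall_lt (hT : IsText T X) (k : ℕ) :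
    ∀ᶠ n in atTop, ∀ x < k, (some x ∈ pref T n ↔ x ∈ X) :=
  (eventually_all_finite (Set.finite_Iio k)).2 fun x _ => hT.eventually_mem_iff x

theorem IsText.eventually_content_eq (hT : IsText T X) (hX : X.Finite) :
    ∀ᶠ n in atTop, ∀ x, (some x ∈ pref T n ↔ x ∈ X) := by
  filter_upwards [(eventually_all_finite hX).2 fun x _ => hT.eventually_mem_iff x] with n hn x
  exact ⟨hT.mem_of_mem_pref, fun hx => (hn x hx).2 hx⟩

theorem IsText.eventually_lt_contentBound (hT : IsText T X) (hX : X.Infinite) (k : ℕ) :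
    ∀ᶠ n in atTop, k < contentBound (pref T n) := by
  obtain ⟨x, hx, hkx⟩ := hX.exists_gt k
  filter_upwards [hT.eventually_mem_iff x] with n hn
  exact hkx.trans (lt_contentBound (hn.2 hx))

/-- On a text, each level has new support only finitely often. -/
theorem IsText.eventually_not_newlySupported (hT : IsText T X) (g : ℕ → ℕ → Bool) (k : ℕ) :
    ∀ᶠ n in atTop, ∀ i, newlySupported g (pref T n) k i = false := by
  obtain ⟨N, hN⟩ := eventually_atTop.1 (hT.eventually_forall_lt k)
  have hagree : ∀ n ≥ N, ∀ j, agrees g (pref T n) k j = agrees g (pref T N) k j := by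
    intro n hn j
    rw [Bool.eq_iff_iff, agrees_iff, agrees_iff]
    exact forall₂_congr fun x hx => by rw [hN n hn x hx, hN N le_rfl x hx]
  by_cases h : ∃ n ≥ N, ∃ i, newlySupported g (pref T n) k i = true
  · obtain ⟨n, hn, i, hi⟩ := h
    filter_upwards [eventually_gt_atTop n] with m hm j
    by_contra hj
    rw [Bool.not_eq_false, newlySupported_iff, length_pref] at hj
    have hsi := (newlySupported_iff.1 hi).1
    have h₁ := (supported_iff.1 hsi).2.2.2
    have h₂ := (supported_iff.1 hj.1).2.2.2
    simp only [hagree n hn, hagree m (hn.trans hm.le)] at h₁ h₂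
    have hij : i = j := by
      rcases lt_trichotomy i j with hlt | heq | hlt
      · simpa [h₁.1] using h₂.2 i hlt
      · exact heq
      · simpa [h₂.1] using h₁.2 j hlt
    have := hj.2 n hm
    rw [take_pref T hm.le, ← hij, hsi] at this
    cases this
  · push Not at h
    filter_upwards [eventually_ge_atTop N] with n hn i
    simpa using h n hn i

theorem IsText.eventually_lt_of_newlySupported (hT : IsText T X) (g : ℕ → ℕ → Bool) (K : ℕ) :
    ∀ᶠ n in atTop, ∀ k i, newlySupported g (pref T n) k i = true → K < k := by
  filter_upwards [(eventually_all_finite (Set.finite_Iic K)).2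
    fun k _ => hT.eventually_not_newlySupported g k] with n hn k i hki
  by_contra hk
  simp [hn k (not_lt.1 hk) i] at hki

end Texts

/-! ### Correctness of the learner -/

section Correctness

variable {g : ℕ → ℕ → Bool} {s : ℕ → ℕ} {f : List ℕ → ℕ}
  {T : ℕ → Option ℕ} {X : Set ℕ}

theorem consLearner_learner
    (hs : ∀ i x, x ∈ Wset (s i) ↔ g i x = true) (hf : ∀ l x, x ∈ Wset (f l) ↔ x ∈ l) :
    ConsLearner (learner g s f) := by
  intro σ x hx
  rcases learner_cases g s f σ with ⟨i, k, hki, h⟩ | h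
  · rw [h, hs]
    exact (supported_iff.1 (newlySupported_iff.1 hki).1).2.2.1 x hx
  · rw [h, hf]
    exact mem_contentList.2 hx

theorem IsText.eventually_mem_learner_iff
    (hs : ∀ i x, x ∈ Wset (s i) ↔ g i x = true) (hf : ∀ l x, x ∈ Wset (f l) ↔ x ∈ l)
    (hT : IsText T X) (x : ℕ) :
    ∀ᶠ n in atTop, (x ∈ Wset (learner g s f (pref T n)) ↔ x ∈ X) := by
  filter_upwards [hT.eventually_mem_iff x, hT.eventually_lt_of_newlySupported g x] with n hn hlt
  rcases learner_cases g s f (pref T n) with ⟨i, k, hki, h⟩ | h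
  · have hag := (supported_iff.1 (newlySupported_iff.1 hki).1).2.2.2.1
    rw [h, hs, ← agrees_iff.1 hag x (hlt k i hki), hn]
  · rw [h, hf, mem_contentList, hn]

theorem finApproxLearns_learner
    (hs : ∀ i x, x ∈ Wset (s i) ↔ g i x = true) (hf : ∀ l x, x ∈ Wset (f l) ↔ x ∈ l)
    (C : Set (Set ℕ)) : FinApproxLearns (learner g s f) C := by
  intro X _ T hT D
  filter_upwards [(eventually_all_finset D).2
    fun x _ => hT.eventually_mem_learner_iff hs hf x] with n hn
  ext x
  exact and_congr_left fun hx => hn x hx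

theorem IsText.wset_eq_of_infinite
    (hs : ∀ i x, x ∈ Wset (s i) ↔ g i x = true) (hf : ∀ l x, x ∈ Wset (f l) ↔ x ∈ l)
    (hT : IsText T X) {d : ℕ}
    (hd : {n | learner g s f (pref T n) = d}.Infinite) : Wset d = X := by
  ext x
  obtain ⟨n, hn, rfl⟩ := ((hT.eventually_mem_learner_iff hs hf x).and_frequently
    (Nat.frequently_atTop_iff_infinite.2 hd)).exists
  exact hn

theorem IsText.partLearns_finite
    (hs : ∀ i x, x ∈ Wset (s i) ↔ g i x = true) (hf : ∀ l x, x ∈ Wset (f l) ↔ x ∈ l)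
    (hT : IsText T X) (hX : X.Finite) :
    ∃ e, {n | learner g s f (pref T n) = e}.Infinite ∧ Wset e = X ∧
      ∀ d, {n | learner g s f (pref T n) = d}.Infinite → d = e := by
  obtain ⟨N, hN⟩ := eventually_atTop.1 (hT.eventually_content_eq hX)
  have hev : ∀ᶠ n in atTop, learner g s f (pref T n) = f (contentList (pref T N)) := by
    filter_upwards [eventually_ge_atTop N,
      hT.eventually_lt_of_newlySupported g (contentBound (pref T N))] with n hn hlt
    have hcong : ∀ x, some x ∈ pref T n ↔ some x ∈ pref T N := fun x => by
      rw [hN n hn x, hN N le_rfl x]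
    rcases learner_cases g s f (pref T n) with ⟨i, k, hki, -⟩ | h
    · have h₁ := (supported_iff.1 (newlySupported_iff.1 hki).1).2.1
      have h₂ : contentBound (pref T n) ≤ contentBound (pref T N) :=
        contentBound_le_iff.2 fun x hx => lt_contentBound ((hcong x).1 hx)
      exact absurd (hlt k i hki) (h₁.trans h₂).not_gt
    · rw [h, contentList_congr hcong]
  have hinf := Nat.frequently_atTop_iff_infinite.1 hev.frequently
  refine ⟨_, hinf, hT.wset_eq_of_infinite hs hf hinf, fun d hd => ?_⟩
  obtain ⟨n, hn, hdn⟩ := (hev.and_frequently (Nat.frequently_atTop_iff_infinite.2 hd)).exists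
  exact hdn.symm.trans hn

theorem IsText.partLearns_infinite
    (hs : ∀ i x, x ∈ Wset (s i) ↔ g i x = true) (hf : ∀ l x, x ∈ Wset (f l) ↔ x ∈ l)
    (hT : IsText T X) (hX : X.Infinite)
    (hmem : ∃ i, ∀ x, g i x = true ↔ x ∈ X) :
    ∃ e, {n | learner g s f (pref T n) = e}.Infinite ∧ Wset e = X ∧
      ∀ d, {n | learner g s f (pref T n) = d}.Infinite → d = e := by
  classical
  obtain ⟨i, hi, hmin⟩ : ∃ i, (∀ x, g i x = true ↔ x ∈ X) ∧
      ∀ j < i, ∃ x, ¬(g j x = true ↔ x ∈ X) :=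
    ⟨Nat.find hmem, Nat.find_spec hmem, fun j hj => by
      simpa only [not_forall] using Nat.find_min hmem hj⟩
  choose! d hd using hmin
  obtain ⟨K, hK⟩ : ∃ K, ∀ j < i, d j < K :=
    ⟨(Finset.range i).sup d + 1, fun j hj =>
      Nat.lt_succ_of_le (Finset.le_sup (f := d) (Finset.mem_range.2 hj))⟩
  have hnot : ∀ᶠ n in atTop, ∀ k > K, ∀ j < i, agrees g (pref T n) k j = false := by
    filter_upwards [hT.eventually_forall_lt K] with n hn k hk j hj
    rw [← Bool.not_eq_true, agrees_iff]
    intro h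
    exact hd j hj ((h _ ((hK j hj).trans hk)).symm.trans (hn _ (hK j hj)))
  obtain ⟨N₀, hN₀⟩ := eventually_atTop.1 (hnot.and (hT.eventually_lt_of_newlySupported g K))
  have hinf : {n | learner g s f (pref T n) = s i}.Infinite := by
    refine Nat.frequently_atTop_iff_infinite.1 (frequently_atTop.2 fun N => ?_)
    set k := max K (contentBound (pref T (max N N₀))) + 1 with hkdef
    have hex : ∃ n, supported g (pref T n) k i = true := by
      obtain ⟨n, h₁, h₂, h₃, h₄⟩ := (hnot.and ((hT.eventually_forall_lt k).and
        ((hT.eventually_lt_contentBound hX i).and (hT.eventually_lt_contentBound hX k)))).exists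
      exact ⟨n, supported_iff.2 ⟨h₃.le, h₄.le, fun x hx => (hi x).2 (hT.mem_of_mem_pref hx),
        agrees_iff.2 fun x hx => (h₂ x hx).trans (hi x).symm, h₁ k (by omega)⟩⟩
    have hsupp := Nat.find_spec hex
    have hn : max N N₀ ≤ Nat.find hex := by
      by_contra hlt
      have h₁ := (supported_iff.1 hsupp).2.1
      have h₂ := contentBound_pref_mono T (not_le.1 hlt).le
      dsimp only at h₂
      omega
    refine ⟨Nat.find hex, (le_max_left _ _).trans hn, learner_eq_of_candidate
      (candidate_iff.2 ⟨k, newlySupported_iff.2 ⟨hsupp, fun m hm => ?_⟩⟩) fun j hj => ?_⟩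
    · rw [length_pref] at hm
      rw [take_pref T hm.le]
      simpa using Nat.find_min hex hm
    · rw [← Bool.not_eq_true, candidate_iff]
      rintro ⟨k', hk'⟩
      obtain ⟨h₁, h₂⟩ := hN₀ _ ((le_max_right _ _).trans hn)
      have h₃ := (supported_iff.1 (newlySupported_iff.1 hk').1).2.2.2.1
      simp [h₁ k' (h₂ k' j hk') j hj] at h₃
  refine ⟨s i, hinf, hT.wset_eq_of_infinite hs hf hinf, fun e he => ?_⟩
  have hWe := hT.wset_eq_of_infinite hs hf he
  obtain ⟨n, hne⟩ := he.nonempty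
  rcases learner_cases g s f (pref T n) with ⟨j, k, hkj, h⟩ | h
  · have hj : ∀ x, g j x = true ↔ x ∈ X := fun x => by
      rw [← hs, ← h, (show learner g s f (pref T n) = e from hne), hWe]
    obtain ⟨h₁, h₂⟩ := (supported_iff.1 (newlySupported_iff.1 hkj).1).2.2.2
    have hij : j = i := by
      rcases lt_trichotomy j i with hlt | heq | hlt
      · exact absurd (hj _) (hd j hlt)
      · exact heq
      · have h₃ : agrees g (pref T n) k i = true :=
          agrees_iff.2 fun x hx => by rw [agrees_iff.1 h₁ x hx, hj, hi]
        simp [h₂ i hlt] at h₃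
    exact hij ▸ hne.symm.trans h
  · refine absurd ?_ hX
    refine (contentList (pref T n)).finite_toSet.subset fun x hx => ?_
    rw [← hWe, ← (show learner g s f (pref T n) = e from hne), h, hf] at hx
    exact hx

theorem partLearns_learner
    (hs : ∀ i x, x ∈ Wset (s i) ↔ g i x = true) (hf : ∀ l x, x ∈ Wset (f l) ↔ x ∈ l)
    {C : Set (Set ℕ)}
    (hC : ∀ X ∈ C, X.Finite ∨ ∃ i, ∀ x, g i x = true ↔ x ∈ X) :
    PartLearns (learner g s f) C := by
  intro X hXC T hT
  by_cases hX : X.Finite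
  · exact hT.partLearns_finite hs hf hX
  · exact hT.partLearns_infinite hs hf hX ((hC X hXC).resolve_left hX)

theorem wset_learner_finite_or
    (hs : ∀ i x, x ∈ Wset (s i) ↔ g i x = true) (hf : ∀ l x, x ∈ Wset (f l) ↔ x ∈ l)
    (σ : List (Option ℕ)) :
    (Wset (learner g s f σ)).Finite ∨ ∃ i, ∀ x, g i x = true ↔ x ∈ Wset (learner g s f σ) := by
  rcases learner_cases g s f σ with ⟨i, k, -, h⟩ | h
  · exact Or.inr ⟨i, fun x => by rw [h, hs]⟩
  · refine Or.inl ((contentList σ).finite_toSet.subset fun x hx => ?_)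
    rw [h, hf] at hx
    exact hx

end Correctness

/-- Every uniformly recursive family is FinApproxConsPart learnable by a
prudent learner (prudence: the learner learns, with respect to the same
criteria, every set it ever conjectures). -/
theorem stmt8 (L : ℕ → Set ℕ)
    (hL : ∃ g : ℕ → ℕ → Bool, Computable₂ g ∧ ∀ i x, g i x = true ↔ x ∈ L i) :
    ∃ M : List (Option ℕ) → ℕ, Computable M ∧ ConsLearner M ∧
      PartLearns M (Set.range L ∪ Conjectured M) ∧
      FinApproxLearns M (Set.range L ∪ Conjectured M) := by
  obtain ⟨g, hg, hgL⟩ := hL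
  obtain ⟨s, hs, hsW⟩ := exists_computable_index hg
  obtain ⟨f, hf, hfW⟩ := exists_computable_index
    (primrec₂_mem (α := ℕ)).to_comp
  simp only [decide_eq_true_eq] at hfW
  refine ⟨learner g s f, computable_learner hg hs hf, consLearner_learner hsW hfW,
    partLearns_learner hsW hfW ?_, finApproxLearns_learner hsW hfW _⟩
  rintro X (⟨i, rfl⟩ | ⟨σ, rfl⟩)
  · exact Or.inr ⟨i, hgL i⟩
  · exact wset_learner_finite_or hsW hfW σ
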